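/- arXiv:2002.10975 — 3 statements merged into one kernel-verified Lean document; each statement's English description precedes it below -/
import Mathlib

section
/- Let ℓ : ℝ^n × ℝ^m → ℝ and g : ℝ^n × ℝ^m → ℝ^m be C² on a neighborhood of z* = (p*, q*), let P* ⊆ ℝ^n be an open neighborhood of p*, and let w : P* → ℝ^n × ℝ^m be a C² function with w(p*) = z* and g(w(p)) = 0 for all p ∈ P*. Suppose λ* ∈ ℝ^m satisfies the first-order condition ∇ℓ(z*) + (∇g(z*))ᵀ λ* = 0, where ∇ℓ(z*) ∈ ℝ^{n+m} is the gradient of ℓ and ∇g(z*) is the m×(n+m) Jacobian of g at z*. Define the reduced merit function ℓ̃ : P* → ℝ by ℓ̃(p) = ℓ(w(p)). Then the n×n Hessian matrix of ℓ̃ at p* satisfies ∇²ℓ̃(p*) = (∇w(p*))ᵀ [∇²ℓ(z*) + Σ_{s=1}^{m} λ*_s ∇²g_s(z*)] ∇w(p*), where ∇w(p*) is the (n+m)×n Jacobian of w at p*, ∇²ℓ(z*) is the (n+m)×(n+m) Hessian of ℓ at z*, and ∇²g_s(z*) is the (n+m)×(n+m) Hessian of the s-th component of g at z*. -/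
open Matrix

noncomputable section

/-- Basis direction indexed by `Fin n ⊕ Fin m` in the product space `ℝⁿ × ℝᵐ`. -/
def dir (n m : ℕ) (k : Fin n ⊕ Fin m) : (Fin n → ℝ) × (Fin m → ℝ) :=
  Sum.elim (fun i => (Pi.single i 1, 0)) (fun j => (0, Pi.single j 1)) k

/-- Gradient (vector of first partial derivatives) of `ℓ : ℝⁿ × ℝᵐ → ℝ` at `z`. -/
def grad (n m : ℕ) (ℓ : (Fin n → ℝ) × (Fin m → ℝ) → ℝ)
    (z : (Fin n → ℝ) × (Fin m → ℝ)) : Fin n ⊕ Fin m → ℝ :=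
  fun k => fderiv ℝ ℓ z (dir n m k)

/-- The `(n+m) × (n+m)` Hessian matrix of `f : ℝⁿ × ℝᵐ → ℝ` at `z`. -/
def hess (n m : ℕ) (f : (Fin n → ℝ) × (Fin m → ℝ) → ℝ)
    (z : (Fin n → ℝ) × (Fin m → ℝ)) : Matrix (Fin n ⊕ Fin m) (Fin n ⊕ Fin m) ℝ :=
  fun k r => iteratedFDeriv ℝ 2 f z ![dir n m k, dir n m r]

/-- The `m × (n+m)` Jacobian matrix of `g : ℝⁿ × ℝᵐ → ℝᵐ` at `z`. -/
def jac (n m : ℕ) (g : (Fin n → ℝ) × (Fin m → ℝ) → Fin m → ℝ)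
    (z : (Fin n → ℝ) × (Fin m → ℝ)) : Matrix (Fin m) (Fin n ⊕ Fin m) ℝ :=
  fun s k => fderiv ℝ g z (dir n m k) s

/-- The `(n+m) × n` Jacobian matrix of `w : ℝⁿ → ℝⁿ × ℝᵐ` at `p`. -/
def jacW (n m : ℕ) (w : (Fin n → ℝ) → (Fin n → ℝ) × (Fin m → ℝ)) (p : Fin n → ℝ) :
    Matrix (Fin n ⊕ Fin m) (Fin n) ℝ :=
  fun k j => Sum.elim (fun i => (fderiv ℝ w p (Pi.single j 1)).1 i)
    (fun i => (fderiv ℝ w p (Pi.single j 1)).2 i) k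

/-- The `n × n` Hessian matrix of `f : ℝⁿ → ℝ` at `p`. -/
def hessRed (n : ℕ) (f : (Fin n → ℝ) → ℝ) (p : Fin n → ℝ) :
    Matrix (Fin n) (Fin n) ℝ :=
  fun i j => iteratedFDeriv ℝ 2 f p ![Pi.single i 1, Pi.single j 1]

theorem aux_chain {E F : Type*} [NormedAddCommGroup E] [NormedSpace ℝ E]
    [NormedAddCommGroup F] [NormedSpace ℝ F] (f : F → ℝ) (w : E → F) (p : E)
    (hf : ContDiffAt ℝ 2 f (w p)) (hw : ContDiffAt ℝ 2 w p) (u v : E) :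
    fderiv ℝ (fderiv ℝ (fun x => f (w x))) p u v =
      fderiv ℝ (fderiv ℝ f) (w p) (fderiv ℝ w p u) (fderiv ℝ w p v)
        + fderiv ℝ f (w p) (fderiv ℝ (fderiv ℝ w) p u v) := by
  have h1 : fderiv ℝ (fun x => f (w x)) =ᶠ[nhds p]
      fun x => (fderiv ℝ f (w x)).comp (fderiv ℝ w x) := by
    have e1 := hw.continuousAt.eventually (hf.eventually (by simp))
    have e2 := hw.eventually (by simp)
    filter_upwards [e1, e2] with x h1 h2
    exact fderiv_comp x (h1.differentiableAt (by simp)) (h2.differentiableAt (by simp))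
  have d1 : DifferentiableAt ℝ (fderiv ℝ f) (w p) :=
    (hf.fderiv_right (m := 1) (by norm_num)).differentiableAt (by simp)
  have d2 : DifferentiableAt ℝ (fderiv ℝ w) p :=
    (hw.fderiv_right (m := 1) (by norm_num)).differentiableAt (by simp)
  have d3 : DifferentiableAt ℝ w p := hw.differentiableAt (by simp)
  have h2 := (d1.hasFDerivAt.comp p d3.hasFDerivAt).clm_comp d2.hasFDerivAt
  rw [h1.fderiv_eq]
  have h3 := h2.fderiv
  simp only [Function.comp_def] at h3
  rw [h3]
  simp [add_comm]

theorem aux_dir (n m : ℕ) (v : (Fin n → ℝ) × (Fin m → ℝ)) :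
    v = ∑ k, (Sum.elim v.1 v.2 k) • dir n m k := by
  ext i <;> simp [dir, Prod.fst_sum, Prod.snd_sum, Finset.sum_apply, Pi.single_apply]

theorem aux_quad (n m : ℕ) (w : (Fin n → ℝ) → (Fin n → ℝ) × (Fin m → ℝ)) (p : Fin n → ℝ)
    (f : (Fin n → ℝ) × (Fin m → ℝ) → ℝ) (z : (Fin n → ℝ) × (Fin m → ℝ)) (i j : Fin n) :
    ((jacW n m w p)ᵀ * hess n m f z * jacW n m w p) i j =
      fderiv ℝ (fderiv ℝ f) z (fderiv ℝ w p (Pi.single i 1)) (fderiv ℝ w p (Pi.single j 1)) := by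
  have hJ : ∀ j, fderiv ℝ w p (Pi.single j 1) = ∑ k, jacW n m w p k j • dir n m k := by
    intro j
    conv_lhs => rw [aux_dir n m (fderiv ℝ w p (Pi.single j 1))]
    refine Finset.sum_congr rfl fun k _ => ?_
    cases k <;> rfl
  rw [hJ i, hJ j, map_sum, map_sum]
  simp only [Matrix.mul_apply, Matrix.transpose_apply]
  refine Finset.sum_congr rfl fun k _ => ?_
  rw [_root_.sum_apply, Finset.sum_mul]
  refine Finset.sum_congr rfl fun r _ => ?_
  rw [ContinuousLinearMap.map_smul, ContinuousLinearMap.map_smul, ContinuousLinearMap.smul_apply]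
  simp only [hess, iteratedFDeriv_two_apply, smul_eq_mul, Matrix.cons_val_zero, Matrix.cons_val_one]
  ring

/-- Hessian of the reduced merit function.
If `ℓ` and `g` are C² near `z* = (p*, q*)`, `w` is a C² local explicit solution of
the constraints with `w p* = z*`, and `λ*` satisfies the first-order condition
`∇ℓ(z*) + (∇g(z*))ᵀ λ* = 0`, then the Hessian of the reduced merit `ℓ̃ = ℓ ∘ w` at
`p*` equals `(∇w)ᵀ [∇²ℓ + Σ_s λ*_s ∇²g_s] ∇w`. -/
theorem reduced_hessian_expression (n m : ℕ)
    (ℓ : (Fin n → ℝ) × (Fin m → ℝ) → ℝ)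
    (g : (Fin n → ℝ) × (Fin m → ℝ) → Fin m → ℝ)
    (pstar : Fin n → ℝ) (qstar : Fin m → ℝ)
    (zstar : (Fin n → ℝ) × (Fin m → ℝ)) (hzstar : zstar = (pstar, qstar))
    (hℓ : ContDiffAt ℝ 2 ℓ zstar) (hg : ContDiffAt ℝ 2 g zstar)
    (Pstar : Set (Fin n → ℝ)) (hPopen : IsOpen Pstar) (hpmem : pstar ∈ Pstar)
    (w : (Fin n → ℝ) → (Fin n → ℝ) × (Fin m → ℝ))
    (hw : ContDiffOn ℝ 2 w Pstar) (hwp : w pstar = zstar)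
    (hconstr : ∀ p ∈ Pstar, g (w p) = 0)
    (lam : Fin m → ℝ)
    (hfoc : grad n m ℓ zstar + (jac n m g zstar)ᵀ.mulVec lam = 0) :
    hessRed n (fun p => ℓ (w p)) pstar =
      (jacW n m w pstar)ᵀ *
        (hess n m ℓ zstar + ∑ s, lam s • hess n m (fun z => g z s) zstar) *
        jacW n m w pstar := by
  have hw' : ContDiffAt ℝ 2 w pstar := hw.contDiffAt (hPopen.mem_nhds hpmem)
  have hgs : ∀ s, ContDiffAt ℝ 2 (fun z => g z s) zstar := fun s => contDiffAt_pi.1 hg s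
  have hL : ∀ v, fderiv ℝ ℓ zstar v + ∑ s, lam s * fderiv ℝ (fun z => g z s) zstar v = 0 := by
    intro v
    have hd : ∀ s v, fderiv ℝ (fun z => g z s) zstar v = fderiv ℝ g zstar v s := by
      intro s v
      have h := (hasFDerivAt_pi'.1 (hg.differentiableAt (by simp)).hasFDerivAt s).fderiv
      rw [h]
      rfl
    have hk : ∀ k, fderiv ℝ ℓ zstar (dir n m k)
        + ∑ s, lam s * fderiv ℝ (fun z => g z s) zstar (dir n m k) = 0 := by
      intro k
      have h := congrFun hfoc k
      simp only [Pi.add_apply, grad, Matrix.mulVec, dotProduct, jac, Matrix.transpose_apply,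
        Pi.zero_apply] at h
      rw [← h]
      congr 1
      exact Finset.sum_congr rfl fun s _ => by rw [hd, mul_comm]
    rw [aux_dir n m v]
    simp only [map_sum, map_smul, smul_eq_mul, Finset.mul_sum]
    rw [Finset.sum_comm, ← Finset.sum_add_distrib]
    refine Finset.sum_eq_zero fun k _ => ?_
    have h := congrArg (fun t => Sum.elim v.1 v.2 k * t) (hk k)
    simp only [mul_add, Finset.mul_sum, mul_zero] at h
    rw [← h]
    congr 1
    exact Finset.sum_congr rfl fun s _ => by ring
  ext i j
  have hg0 : ∀ s, fderiv ℝ (fderiv ℝ (fun p => g (w p) s)) pstar = 0 := by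
    intro s
    have e : (fun p => g (w p) s) =ᶠ[nhds pstar] fun _ => (0 : ℝ) := by
      filter_upwards [hPopen.mem_nhds hpmem] with p hp
      rw [hconstr p hp]; rfl
    rw [e.fderiv.fderiv_eq]
    simp
  subst hwp
  have c1 := aux_chain ℓ w pstar hℓ hw' (Pi.single i 1) (Pi.single j 1)
  have c2 := fun s => aux_chain (fun z => g z s) w pstar (hgs s) hw' (Pi.single i 1) (Pi.single j 1)
  simp only [hg0, ContinuousLinearMap.zero_apply] at c2
  have h := hL (fderiv ℝ (fderiv ℝ w) pstar (Pi.single i 1) (Pi.single j 1))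
  simp only [Matrix.mul_add, Matrix.add_mul, Matrix.mul_sum, Matrix.sum_mul, Matrix.mul_smul,
    Matrix.smul_mul, Matrix.add_apply, Matrix.sum_apply, Matrix.smul_apply, aux_quad, smul_eq_mul]
  simp only [hessRed, iteratedFDeriv_two_apply, Matrix.cons_val_zero, Matrix.cons_val_one]
  rw [c1]
  have h2 := Finset.sum_congr (rfl : (Finset.univ : Finset (Fin m)) = _)
    fun s _ => congrArg (fun t => lam s * t) (c2 s)
  simp only [mul_zero, Finset.sum_const_zero, mul_add, Finset.sum_add_distrib] at h2
  linarith
end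
end

section
/- Let ℓ : ℝ^n × ℝ^m → ℝ and g : ℝ^n × ℝ^m → ℝ^m be C² on a neighborhood of z* = (p*, q*) with g(z*) = 0, and suppose the m×m Jacobian ∇_q g(z*) is invertible. Let P* ⊆ ℝ^n be an open neighborhood of p* and w : P* → ℝ^n × ℝ^m a C² function with w(p*) = z*, g(w(p)) = 0 for all p ∈ P*, and Jacobian ∇w(p*) = [I_n ; −(∇_q g(z*))⁻¹ ∇_p g(z*)]. Suppose λ* ∈ ℝ^m satisfies ∇ℓ(z*) + (∇g(z*))ᵀ λ* = 0, and that the second-order sufficient condition holds: vᵀ [∇²ℓ(z*) + Σ_{s=1}^{m} λ*_s ∇²g_s(z*)] v < 0 for every nonzero v ∈ ℝ^{n+m} with ∇g(z*) v = 0. Then the n×n Hessian matrix of the reduced merit ℓ̃(p) = ℓ(w(p)) at p* is negative definite, and in particular invertible. -/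
open Matrix

noncomputable section

lemma comp2_aux {E F : Type*} [NormedAddCommGroup E] [NormedSpace ℝ E] [NormedAddCommGroup F]
    [NormedSpace ℝ F] (f : F → ℝ) (w : E → F) (p : E) (hf : ContDiffAt ℝ 2 f (w p))
    (hw : ContDiffAt ℝ 2 w p) (h0 : fderiv ℝ f (w p) = 0) (u v : E) :
    fderiv ℝ (fderiv ℝ (fun x => f (w x))) p u v =
      fderiv ℝ (fderiv ℝ f) (w p) (fderiv ℝ w p u) (fderiv ℝ w p v) := by
  have hfe : ∀ᶠ z in nhds (w p), ContDiffAt ℝ 2 f z := hf.eventually (by simp)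
  have hwe : ∀ᶠ x in nhds p, ContDiffAt ℝ 2 w x := hw.eventually (by simp)
  have hfe' := hw.continuousAt.eventually hfe
  have e : fderiv ℝ (fun x => f (w x)) =ᶠ[nhds p]
      fun x => (fderiv ℝ f (w x)).comp (fderiv ℝ w x) := by
    filter_upwards [hwe, hfe'] with x h1 h2
    exact fderiv_comp x (h2.differentiableAt (by simp)) (h1.differentiableAt (by simp))
  rw [e.fderiv_eq]
  have d1 : DifferentiableAt ℝ (fderiv ℝ f) (w p) :=
    (hf.fderiv_right (m := 1) (by norm_num)).differentiableAt (by simp)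
  have d2 : DifferentiableAt ℝ (fderiv ℝ w) p :=
    (hw.fderiv_right (m := 1) (by norm_num)).differentiableAt (by simp)
  have d3 : HasFDerivAt (fun x => fderiv ℝ f (w x)) _ p :=
    d1.hasFDerivAt.comp p (hw.differentiableAt (by simp)).hasFDerivAt
  rw [(d3.clm_comp d2.hasFDerivAt).fderiv]
  simp [h0]

lemma quad_aux {ι E : Type*} [Fintype ι] [NormedAddCommGroup E] [NormedSpace ℝ E]
    (B : E →L[ℝ] E →L[ℝ] ℝ) (b : ι → E) (M : Matrix ι ι ℝ)
    (hM : ∀ i j, M i j = B (b i) (b j)) (u : ι → ℝ) :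
    u ⬝ᵥ M.mulVec u = B (∑ i, u i • b i) (∑ i, u i • b i) := by
  simp only [dotProduct, Matrix.mulVec, hM, map_sum, map_smul, _root_.sum_apply,
    _root_.smul_apply, smul_eq_mul, Finset.mul_sum]
  rw [Finset.sum_comm]
  refine Finset.sum_congr rfl fun i _ => Finset.sum_congr rfl fun j _ => by ring

lemma dir_sum (n m : ℕ) (x : (Fin n → ℝ) × (Fin m → ℝ)) :
    ∑ k, (Sum.elim x.1 x.2 k : ℝ) • dir n m k = x := by
  rw [Fintype.sum_sum_type]
  ext i <;> simp [dir, Prod.fst_sum, Prod.snd_sum, Finset.sum_apply, Pi.single_apply]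


/-- Invertibility of the reduced Hessian.
Under the first-order condition and the second-order sufficient condition for a
constrained maximum, the Hessian of the reduced merit `ℓ̃ = ℓ ∘ w` at `p*` is
negative definite, and in particular invertible. -/
theorem reduced_hessian_negdef (n m : ℕ)
    (ℓ : (Fin n → ℝ) × (Fin m → ℝ) → ℝ)
    (g : (Fin n → ℝ) × (Fin m → ℝ) → Fin m → ℝ)
    (pstar : Fin n → ℝ) (qstar : Fin m → ℝ)
    (zstar : (Fin n → ℝ) × (Fin m → ℝ)) (hzstar : zstar = (pstar, qstar))
    (hg0 : g zstar = 0)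
    (hℓ : ContDiffAt ℝ 2 ℓ zstar) (hg : ContDiffAt ℝ 2 g zstar)
    (hGq : IsUnit ((jac n m g zstar).submatrix id Sum.inr).det)
    (Pstar : Set (Fin n → ℝ)) (hPopen : IsOpen Pstar) (hpmem : pstar ∈ Pstar)
    (w : (Fin n → ℝ) → (Fin n → ℝ) × (Fin m → ℝ))
    (hw : ContDiffOn ℝ 2 w Pstar) (hwp : w pstar = zstar)
    (hconstr : ∀ p ∈ Pstar, g (w p) = 0)
    (hJw : jacW n m w pstar =
      Matrix.fromRows (1 : Matrix (Fin n) (Fin n) ℝ)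
        (-(((jac n m g zstar).submatrix id Sum.inr)⁻¹ *
          (jac n m g zstar).submatrix id Sum.inl)))
    (lam : Fin m → ℝ)
    (hfoc : grad n m ℓ zstar + (jac n m g zstar)ᵀ.mulVec lam = 0)
    (hsoc : ∀ v : Fin n ⊕ Fin m → ℝ, v ≠ 0 → (jac n m g zstar).mulVec v = 0 →
      v ⬝ᵥ (hess n m ℓ zstar +
        ∑ s, lam s • hess n m (fun z => g z s) zstar).mulVec v < 0) :
    (∀ u : Fin n → ℝ, u ≠ 0 →
      u ⬝ᵥ (hessRed n (fun p => ℓ (w p)) pstar).mulVec u < 0) ∧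
    IsUnit (hessRed n (fun p => ℓ (w p)) pstar).det := by
  have hwA : ContDiffAt ℝ 2 w pstar := hw.contDiffAt (hPopen.mem_nhds hpmem)
  have hgs : ∀ s, ContDiffAt ℝ 2 (fun z => g z s) zstar := fun s => contDiffAt_pi.1 hg s
  have hsm : ∀ s, ContDiffAt ℝ 2 (fun z => lam s * g z s) zstar := fun s =>
    contDiffAt_const.mul (hgs s)
  have hsum : ContDiffAt ℝ 2 (fun z => ∑ s, lam s * g z s) zstar :=
    ContDiffAt.sum fun s _ => hsm s
  set L : (Fin n → ℝ) × (Fin m → ℝ) → ℝ := fun z => ℓ z + ∑ s, lam s * g z s with hLdef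
  have hL : ContDiffAt ℝ 2 L zstar := hℓ.add hsum
  have hgd : DifferentiableAt ℝ g zstar := hg.differentiableAt (by simp)
  have hgds : ∀ s x, fderiv ℝ (fun z => g z s) zstar x = fderiv ℝ g zstar x s := by
    intro s x
    rw [fderiv_apply hgd s]
    rfl
  -- first derivative vanishes
  have hdL : fderiv ℝ L zstar = 0 := by
    have h1 : ∀ x, fderiv ℝ L zstar x =
        fderiv ℝ ℓ zstar x + ∑ s, lam s * fderiv ℝ g zstar x s := by
      intro x
      have := (hℓ.differentiableAt (by simp)).hasFDerivAt.add
        (HasFDerivAt.fun_sum (u := Finset.univ) fun s _ =>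
          ((hgs s).differentiableAt (by simp)).hasFDerivAt.const_mul (lam s))
      have h2 : fderiv ℝ L zstar = _ := this.fderiv
      rw [h2]
      simp [hgds]
    have h2 : ∀ k, fderiv ℝ L zstar (dir n m k) = 0 := by
      intro k
      rw [h1]
      have := congrFun hfoc k
      simp only [Pi.add_apply, grad, Matrix.mulVec, dotProduct, Matrix.transpose_apply, jac,
        Pi.zero_apply] at this
      rw [← this]
      congr 1
      exact Finset.sum_congr rfl fun s _ => mul_comm _ _
    refine ContinuousLinearMap.ext fun x => ?_
    rw [← dir_sum n m x, map_sum]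
    simp [h2]
  -- Hessian of L
  have hHL : ∀ k r, (hess n m ℓ zstar + ∑ s, lam s • hess n m (fun z => g z s) zstar) k r =
      fderiv ℝ (fderiv ℝ L) zstar (dir n m k) (dir n m r) := by
    intro k r
    have e : fderiv ℝ L =ᶠ[nhds zstar]
        fun z => fderiv ℝ ℓ z + ∑ s, lam s • fderiv ℝ (fun z => g z s) z := by
      have a1 := hℓ.eventually (by simp)
      have a2 : ∀ᶠ z in nhds zstar, ∀ s, ContDiffAt ℝ 2 (fun z => g z s) z :=
        Filter.eventually_all.2 fun s => (hgs s).eventually (by simp)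
      filter_upwards [a1, a2] with z b1 b2
      exact ((b1.differentiableAt (by simp)).hasFDerivAt.add
        (HasFDerivAt.fun_sum (u := Finset.univ) fun s _ =>
          ((b2 s).differentiableAt (by simp)).hasFDerivAt.const_mul (lam s))).fderiv
    have d1 : ∀ f : (Fin n → ℝ) × (Fin m → ℝ) → ℝ, ContDiffAt ℝ 2 f zstar →
        HasFDerivAt (fderiv ℝ f) (fderiv ℝ (fderiv ℝ f) zstar) zstar := fun f hf =>
      ((hf.fderiv_right (m := 1) (by norm_num)).differentiableAt (by simp)).hasFDerivAt
    have d2 := (d1 ℓ hℓ).add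
        (HasFDerivAt.fun_sum (u := Finset.univ) fun s _ => (d1 _ (hgs s)).const_smul (lam s))
    rw [e.fderiv_eq]
    have d3 : fderiv ℝ (fun z => fderiv ℝ ℓ z + ∑ s, lam s • fderiv ℝ (fun z => g z s) z) zstar
      = _ := d2.fderiv
    rw [d3]
    simp [hess, iteratedFDeriv_two_apply, Matrix.sum_apply]
  -- reduced Hessian
  have hRed : ∀ i j, hessRed n (fun p => ℓ (w p)) pstar i j =
      fderiv ℝ (fderiv ℝ (fun p => L (w p))) pstar (Pi.single i 1) (Pi.single j 1) := by
    intro i j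
    have e : (fun p => ℓ (w p)) =ᶠ[nhds pstar] fun p => L (w p) := by
      filter_upwards [hPopen.mem_nhds hpmem] with p hp
      simp [hLdef, hconstr p hp]
    simp only [hessRed, iteratedFDeriv_two_apply]
    rw [e.fderiv.fderiv_eq]
    rfl
  have hsingle : ∀ u : Fin n → ℝ, ∑ i, u i • (Pi.single i 1 : Fin n → ℝ) = u := by
    intro u
    ext i
    simp [Finset.sum_apply, Pi.single_apply]
  have main : ∀ u : Fin n → ℝ, u ≠ 0 →
      u ⬝ᵥ (hessRed n (fun p => ℓ (w p)) pstar).mulVec u < 0 := by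
    intro u hu
    rw [quad_aux _ _ _ hRed u, hsingle, comp2_aux L w pstar (hwp ▸ hL) hwA (hwp ▸ hdL), hwp]
    set x := fderiv ℝ w pstar u with hx
    have hx1 : x.1 = u := by
      ext i
      have : x = ∑ j, u j • fderiv ℝ w pstar (Pi.single j 1) := by
        rw [hx]
        conv_lhs => rw [← hsingle u]
        simp only [map_sum, map_smul]
      rw [this, Prod.fst_sum, Finset.sum_apply]
      have h3 : ∀ j, (fderiv ℝ w pstar (Pi.single j 1)).1 i = (1 : Matrix (Fin n) (Fin n) ℝ) i j :=
        fun j => congrFun (congrFun hJw (Sum.inl i)) j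
      simp [h3, Matrix.one_apply]
    have hs := hsoc (Sum.elim x.1 x.2) ?_ ?_
    · rwa [quad_aux _ _ _ hHL, dir_sum] at hs
    · intro h
      apply hu
      rw [← hx1]
      ext i
      exact congrFun h (Sum.inl i)
    · have h4 : fderiv ℝ g zstar x = 0 := by
        have e : (fun p => g (w p)) =ᶠ[nhds pstar] fun _ => 0 := by
          filter_upwards [hPopen.mem_nhds hpmem] with p hp
          exact hconstr p hp
        have h5 := fderiv_comp pstar (hwp.symm ▸ hgd : DifferentiableAt ℝ g (w pstar))
          (hwA.differentiableAt (by simp))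
        have h6 : fderiv ℝ (g ∘ w) pstar = 0 := by
          have := e.fderiv_eq (𝕜 := ℝ)
          exact this.trans (by simp)
        rw [h6, hwp] at h5
        exact (congrArg (fun T => T u) h5).symm
      rw [← dir_sum n m x, map_sum] at h4
      ext s
      have := congrFun h4 s
      rw [Finset.sum_apply] at this
      simp only [Matrix.mulVec, dotProduct, jac]
      rw [← this]
      refine Finset.sum_congr rfl fun k _ => ?_
      rw [map_smul, Pi.smul_apply, smul_eq_mul, mul_comm]
  refine ⟨main, ?_⟩
  rw [isUnit_iff_ne_zero]
  intro hdet
  obtain ⟨v, hv, hv0⟩ := Matrix.exists_mulVec_eq_zero_iff.2 hdet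
  have := main v hv
  rw [hv0] at this
  simp at this
end
end

section
/- Let ℓ : ℝ^n × ℝ^m → ℝ and g : ℝ^n × ℝ^m → ℝ^m be C² on a neighborhood of z* = (p*, q*) with g(z*) = 0, and suppose the m×m Jacobian ∇_q g(z*) is invertible. Let P* ⊆ ℝ^n be an open neighborhood of p* and w : P* → ℝ^n × ℝ^m a C² function with w(p*) = z*, g(w(p)) = 0 for all p ∈ P*, and Jacobian ∇w(p*) = [I_n ; −(∇_q g(z*))⁻¹ ∇_p g(z*)]. Suppose λ* ∈ ℝ^m satisfies ∇ℓ(z*) + (∇g(z*))ᵀ λ* = 0, and that vᵀ [∇²ℓ(z*) + Σ_{s=1}^{m} λ*_s ∇²g_s(z*)] v < 0 for every nonzero v ∈ ℝ^{n+m} with ∇g(z*) v = 0. Let H_L = [[∇²ℓ(z*) + Σ_{s} λ*_s ∇²g_s(z*), (∇g(z*))ᵀ], [∇g(z*), 0]] and ℓ̃(p) = ℓ(w(p)). Then the (n+m)×(n+m) matrix ∇w(p*) · (∇²ℓ̃(p*))⁻¹ · (∇w(p*))ᵀ equals the submatrix of H_L⁻¹ formed by its first n+m rows and first n+m columns. 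-/
open Matrix

noncomputable section

theorem aux_hess_comp {E F : Type*} [NormedAddCommGroup E] [NormedSpace ℝ E]
    [NormedAddCommGroup F] [NormedSpace ℝ F] (L : F → ℝ) (w : E → F) (p : E)
    (hL : ContDiffAt ℝ 2 L (w p)) (hw : ContDiffAt ℝ 2 w p) (h0 : fderiv ℝ L (w p) = 0)
    (u v : E) :
    iteratedFDeriv ℝ 2 (fun x => L (w x)) p ![u, v] =
      iteratedFDeriv ℝ 2 L (w p) ![fderiv ℝ w p u, fderiv ℝ w p v] := by
  rw [iteratedFDeriv_two_apply, iteratedFDeriv_two_apply]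
  simp only [Matrix.cons_val_zero, Matrix.cons_val_one]
  have hev : fderiv ℝ (fun x => L (w x)) =ᶠ[nhds p]
      fun x => (fderiv ℝ L (w x)).comp (fderiv ℝ w x) := by
    have h1 : ∀ᶠ x in nhds p, ContDiffAt ℝ 2 w x := hw.eventually (by simp)
    have h2 : ∀ᶠ x in nhds p, ContDiffAt ℝ 2 L (w x) :=
      hw.continuousAt.eventually (hL.eventually (by simp))
    filter_upwards [h1, h2] with x hx1 hx2
    exact fderiv_comp x (hx2.differentiableAt (by simp)) (hx1.differentiableAt (by simp))
  rw [hev.fderiv_eq]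
  have hdw : DifferentiableAt ℝ w p := hw.differentiableAt (by simp)
  have hdL' : DifferentiableAt ℝ (fderiv ℝ L) (w p) :=
    (hL.fderiv_right (m := 1) (by norm_num)).differentiableAt (by simp)
  have hdw' : DifferentiableAt ℝ (fderiv ℝ w) p :=
    (hw.fderiv_right (m := 1) (by norm_num)).differentiableAt (by simp)
  have hc : HasFDerivAt (fun x => fderiv ℝ L (w x))
      ((fderiv ℝ (fderiv ℝ L) (w p)).comp (fderiv ℝ w p)) p :=
    hdL'.hasFDerivAt.comp p hdw.hasFDerivAt
  rw [(hc.clm_comp hdw'.hasFDerivAt).fderiv]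
  simp [h0]

theorem aux_jacW_expand (n m : ℕ) (w : (Fin n → ℝ) → (Fin n → ℝ) × (Fin m → ℝ))
    (p : Fin n → ℝ) (j : Fin n) :
    fderiv ℝ w p (Pi.single j 1) = ∑ k, jacW n m w p k j • dir n m k := by
  rw [Fintype.sum_sum_type]
  simp only [jacW, dir, Sum.elim_inl, Sum.elim_inr]
  ext i
  · simp [Prod.fst_sum, Finset.sum_apply, Pi.single_apply]
  · simp [Prod.snd_sum, Finset.sum_apply, Pi.single_apply]

theorem aux_bilin (n m : ℕ) (f : (Fin n → ℝ) × (Fin m → ℝ) → ℝ)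
    (z : (Fin n → ℝ) × (Fin m → ℝ)) (a b : Fin n ⊕ Fin m → ℝ) :
    iteratedFDeriv ℝ 2 f z ![∑ k, a k • dir n m k, ∑ k, b k • dir n m k] =
      a ⬝ᵥ (hess n m f z).mulVec b := by
  simp only [hess, dotProduct, mulVec, iteratedFDeriv_two_apply, Matrix.cons_val_zero,
    Matrix.cons_val_one, map_sum, map_smul, ContinuousLinearMap.sum_apply,
    ContinuousLinearMap.smul_apply, smul_eq_mul]
  simp only [Finset.mul_sum]
  rw [Finset.sum_comm]
  refine Finset.sum_congr rfl fun k _ => ?_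
  refine Finset.sum_congr rfl fun r _ => ?_
  ring

theorem aux_fderiv_zero (n m : ℕ) (T : (Fin n → ℝ) × (Fin m → ℝ) →L[ℝ] ℝ)
    (h : ∀ k, T (dir n m k) = 0) : T = 0 := by
  refine ContinuousLinearMap.ext fun x => ?_
  have hx : x = ∑ k, Sum.elim x.1 x.2 k • dir n m k := by
    rw [Fintype.sum_sum_type]
    simp only [dir, Sum.elim_inl, Sum.elim_inr]
    ext i
    · simp [Prod.fst_sum, Finset.sum_apply, Pi.single_apply]
    · simp [Prod.snd_sum, Finset.sum_apply, Pi.single_apply]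
  rw [hx, map_sum]
  simp [h]

theorem aux_linalg (n m : ℕ) (A : Matrix (Fin n ⊕ Fin m) (Fin n ⊕ Fin m) ℝ)
    (G : Matrix (Fin m) (Fin n ⊕ Fin m) ℝ)
    (hGq : IsUnit (G.submatrix id Sum.inr).det)
    (W : Matrix (Fin n ⊕ Fin m) (Fin n) ℝ)
    (hW : W = Matrix.fromRows (1 : Matrix (Fin n) (Fin n) ℝ)
        (-((G.submatrix id Sum.inr)⁻¹ * G.submatrix id Sum.inl)))
    (hsoc : ∀ v : Fin n ⊕ Fin m → ℝ, v ≠ 0 → G.mulVec v = 0 → v ⬝ᵥ A.mulVec v < 0) :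
    W * (Wᵀ * A * W)⁻¹ * Wᵀ =
      (Matrix.fromBlocks A Gᵀ G 0)⁻¹.submatrix
        (Sum.inl : Fin n ⊕ Fin m → (Fin n ⊕ Fin m) ⊕ Fin m)
        (Sum.inl : Fin n ⊕ Fin m → (Fin n ⊕ Fin m) ⊕ Fin m) := by
  obtain ⟨Gp, hGp⟩ : ∃ Gp, Gp = G.submatrix id Sum.inl := ⟨_, rfl⟩
  obtain ⟨Gq, hGq'⟩ : ∃ Gq, Gq = G.submatrix id Sum.inr := ⟨_, rfl⟩
  rw [← hGp, ← hGq'] at hW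
  rw [← hGq'] at hGq
  have hG : G = Matrix.fromCols Gp Gq := by
    subst hGp hGq'
    ext i (j | j) <;> rfl
  have hGW : G * W = 0 := by
    rw [hG, hW, Matrix.fromCols_mul_fromRows, Matrix.mul_neg, ← Matrix.mul_assoc,
      Matrix.mul_nonsing_inv _ hGq]
    simp
  have hWinj : ∀ x, W.mulVec x = 0 → x = 0 := by
    intro x hx
    rw [hW, Matrix.fromRows_mulVec] at hx
    ext i
    simpa using congrFun hx (Sum.inl i)
  have hS : IsUnit (Wᵀ * A * W) := by
    rw [← Matrix.mulVec_injective_iff_isUnit]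
    refine (injective_iff_map_eq_zero (Matrix.mulVecLin (Wᵀ * A * W))).2 ?_
    intro x hx
    by_contra hne
    have h1 : W.mulVec x ≠ 0 := fun h => hne (hWinj x h)
    have h2 := hsoc _ h1 (by rw [Matrix.mulVec_mulVec, hGW, Matrix.zero_mulVec])
    have h3 : x ⬝ᵥ (Wᵀ * A * W).mulVec x = 0 := by
      have : (Wᵀ * A * W).mulVec x = 0 := hx
      rw [this, dotProduct_zero]
    rw [← Matrix.mulVec_mulVec, ← Matrix.mulVec_mulVec, Matrix.dotProduct_mulVec,
      Matrix.vecMul_transpose] at h3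
    linarith
  have hSd := (Matrix.isUnit_iff_isUnit_det _).1 hS
  have hM : IsUnit (Matrix.fromBlocks A Gᵀ G 0) := by
    rw [← Matrix.mulVec_injective_iff_isUnit]
    refine (injective_iff_map_eq_zero (Matrix.mulVecLin (Matrix.fromBlocks A Gᵀ G 0))).2 ?_
    intro x hx
    have hx' : (Matrix.fromBlocks A Gᵀ G 0).mulVec x = 0 := hx
    obtain ⟨a, b, rfl⟩ : ∃ a b, x = Sum.elim a b :=
      ⟨x ∘ Sum.inl, x ∘ Sum.inr, (Sum.elim_comp_inl_inr x).symm⟩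
    rw [Matrix.fromBlocks_mulVec] at hx'
    have e1 : A.mulVec a + Gᵀ.mulVec b = 0 := by
      ext i; simpa using congrFun hx' (Sum.inl i)
    have e2 : G.mulVec a = 0 := by
      ext i; simpa using congrFun hx' (Sum.inr i)
    have ha : a = 0 := by
      by_contra hne
      have h2 := hsoc a hne e2
      have h3 : a ⬝ᵥ (A.mulVec a + Gᵀ.mulVec b) = 0 := by rw [e1, dotProduct_zero]
      rw [dotProduct_add, Matrix.dotProduct_mulVec a Gᵀ, Matrix.vecMul_transpose, e2,
        zero_dotProduct] at h3
      linarith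
    subst ha
    rw [Matrix.mulVec_zero, zero_add] at e1
    have e3 : Gqᵀ.mulVec b = 0 := by
      ext i
      have := congrFun e1 (Sum.inr i)
      rw [hG, Matrix.transpose_fromCols, Matrix.fromRows_mulVec] at this
      simpa using this
    have hb : b = 0 := by
      have hT : IsUnit Gqᵀ.det := by rwa [Matrix.det_transpose]
      have : (Gqᵀ⁻¹ * Gqᵀ).mulVec b = 0 := by
        rw [← Matrix.mulVec_mulVec, e3, Matrix.mulVec_zero]
      rwa [Matrix.nonsing_inv_mul _ hT, Matrix.one_mulVec] at this
    subst hb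
    ext (i | i) <;> rfl
  have hMd := (Matrix.isUnit_iff_isUnit_det _).1 hM
  set X := W * (Wᵀ * A * W)⁻¹ * Wᵀ with hX
  have hGX : G * X = 0 := by
    rw [hX, ← Matrix.mul_assoc, ← Matrix.mul_assoc, hGW, Matrix.zero_mul, Matrix.zero_mul]
  obtain ⟨R, hR⟩ : ∃ R, R = 1 - A * X := ⟨_, rfl⟩
  have hWR : Wᵀ * R = 0 := by
    have : Wᵀ * (A * X) = (Wᵀ * A * W) * (Wᵀ * A * W)⁻¹ * Wᵀ := by
      rw [hX]; simp only [Matrix.mul_assoc]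
    rw [hR, Matrix.mul_sub, this, Matrix.mul_nonsing_inv _ hSd]
    simp
  obtain ⟨Y, hY⟩ : ∃ Y, Y = Gqᵀ⁻¹ * R.toRows₂ := ⟨_, rfl⟩
  have hT : IsUnit Gqᵀ.det := by rwa [Matrix.det_transpose]
  have hGY : Gᵀ * Y = R := by
    have hRR := Matrix.fromRows_toRows R
    rw [hG, Matrix.transpose_fromCols, Matrix.fromRows_mul]
    conv_rhs => rw [← hRR]
    congr 1
    · rw [← hRR, hW, Matrix.transpose_fromRows, Matrix.fromCols_mul_fromRows] at hWR
      rw [Matrix.transpose_neg, Matrix.transpose_mul, Matrix.transpose_nonsing_inv,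
        Matrix.transpose_one, Matrix.one_mul, Matrix.neg_mul, Matrix.mul_assoc, ← hY] at hWR
      exact (add_neg_eq_zero.1 hWR).symm
    · rw [hY, ← Matrix.mul_assoc, Matrix.mul_nonsing_inv _ hT, Matrix.one_mul]
  have hprod : Matrix.fromBlocks A Gᵀ G 0 * Matrix.fromRows X Y = Matrix.fromRows (1 : Matrix (Fin n ⊕ Fin m) (Fin n ⊕ Fin m) ℝ)
      (0 : Matrix (Fin m) (Fin n ⊕ Fin m) ℝ) := by
    rw [Matrix.fromBlocks_mul_fromRows, hGX, hGY, hR]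
    simp
  have hfin : Matrix.fromRows X Y = (Matrix.fromBlocks A Gᵀ G 0)⁻¹ * Matrix.fromRows (1 : Matrix (Fin n ⊕ Fin m) (Fin n ⊕ Fin m) ℝ)
      (0 : Matrix (Fin m) (Fin n ⊕ Fin m) ℝ) := by
    rw [← hprod, ← Matrix.mul_assoc, Matrix.nonsing_inv_mul _ hMd, Matrix.one_mul]
  ext i j
  have := congrFun (congrFun hfin (Sum.inl i)) j
  rw [Matrix.fromRows_apply_inl] at this
  rw [this, Matrix.mul_apply, Fintype.sum_sum_type]
  simp [Matrix.one_apply]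

/-- Approximate covariance of all decision variables.
Under the hypotheses of a well-posed equality-constrained maximum, the matrix
`∇w(p*) (∇²ℓ̃(p*))⁻¹ (∇w(p*))ᵀ` equals the first `n+m` rows and `n+m` columns of
the inverse bordered Hessian `H_L⁻¹`. -/
theorem full_decision_covariance (n m : ℕ)
    (ℓ : (Fin n → ℝ) × (Fin m → ℝ) → ℝ)
    (g : (Fin n → ℝ) × (Fin m → ℝ) → Fin m → ℝ)
    (pstar : Fin n → ℝ) (qstar : Fin m → ℝ)
    (zstar : (Fin n → ℝ) × (Fin m → ℝ)) (hzstar : zstar = (pstar, qstar))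
    (hg0 : g zstar = 0)
    (hℓ : ContDiffAt ℝ 2 ℓ zstar) (hg : ContDiffAt ℝ 2 g zstar)
    (hGq : IsUnit ((jac n m g zstar).submatrix id Sum.inr).det)
    (Pstar : Set (Fin n → ℝ)) (hPopen : IsOpen Pstar) (hpmem : pstar ∈ Pstar)
    (w : (Fin n → ℝ) → (Fin n → ℝ) × (Fin m → ℝ))
    (hw : ContDiffOn ℝ 2 w Pstar) (hwp : w pstar = zstar)
    (hconstr : ∀ p ∈ Pstar, g (w p) = 0)
    (hJw : jacW n m w pstar =
      Matrix.fromRows (1 : Matrix (Fin n) (Fin n) ℝ)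
        (-(((jac n m g zstar).submatrix id Sum.inr)⁻¹ *
          (jac n m g zstar).submatrix id Sum.inl)))
    (lam : Fin m → ℝ)
    (hfoc : grad n m ℓ zstar + (jac n m g zstar)ᵀ.mulVec lam = 0)
    (hsoc : ∀ v : Fin n ⊕ Fin m → ℝ, v ≠ 0 → (jac n m g zstar).mulVec v = 0 →
      v ⬝ᵥ (hess n m ℓ zstar +
        ∑ s, lam s • hess n m (fun z => g z s) zstar).mulVec v < 0) :
    jacW n m w pstar * (hessRed n (fun p => ℓ (w p)) pstar)⁻¹ *
        (jacW n m w pstar)ᵀ =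
      (Matrix.fromBlocks
        (hess n m ℓ zstar + ∑ s, lam s • hess n m (fun z => g z s) zstar)
        (jac n m g zstar)ᵀ (jac n m g zstar) 0)⁻¹.submatrix
        (Sum.inl : Fin n ⊕ Fin m → (Fin n ⊕ Fin m) ⊕ Fin m)
        (Sum.inl : Fin n ⊕ Fin m → (Fin n ⊕ Fin m) ⊕ Fin m) := by
  have hwA : ContDiffAt ℝ 2 w pstar := hw.contDiffAt (hPopen.mem_nhds hpmem)
  have hgs : ∀ s, ContDiffAt ℝ 2 (fun z => g z s) zstar := fun s => contDiffAt_pi.1 hg s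
  obtain ⟨L, hLdef⟩ : ∃ L : (Fin n → ℝ) × (Fin m → ℝ) → ℝ,
    L = ℓ + fun z => ∑ s, (lam s • fun z => g z s) z := ⟨_, rfl⟩
  have hterm : ∀ s, ContDiffAt ℝ 2 (lam s • fun z => g z s) zstar :=
    fun s => (hgs s).const_smul (lam s)
  have hsum : ContDiffAt ℝ 2 (fun z => ∑ s, (lam s • fun z => g z s) z) zstar :=
    ContDiffAt.sum fun s _ => hterm s
  have hL : ContDiffAt ℝ 2 L zstar := by
    rw [hLdef]; exact hℓ.add hsum
  have hHess : hess n m L zstar =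
      hess n m ℓ zstar + ∑ s, lam s • hess n m (fun z => g z s) zstar := by
    ext k r
    rw [Matrix.add_apply, Matrix.sum_apply]
    simp only [Matrix.smul_apply, hess]
    rw [hLdef, iteratedFDeriv_add_apply hℓ hsum, iteratedFDeriv_fun_sum_apply (fun s _ => hterm s)]
    simp only [ContinuousMultilinearMap.add_apply, ContinuousMultilinearMap.sum_apply]
    congr 1
    refine Finset.sum_congr rfl fun s _ => ?_
    rw [iteratedFDeriv_const_smul_apply (hgs s)]
    rfl
  have hD0 : fderiv ℝ L zstar = 0 := by
    refine aux_fderiv_zero n m _ fun k => ?_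
    have h1 : HasFDerivAt L (fderiv ℝ ℓ zstar +
        ∑ s, lam s • (ContinuousLinearMap.proj s).comp (fderiv ℝ g zstar)) zstar := by
      rw [hLdef]
      refine (hℓ.differentiableAt (by simp)).hasFDerivAt.add ?_
      refine HasFDerivAt.fun_sum fun s _ => ?_
      exact ((hasFDerivAt_pi'.1 (hg.differentiableAt (by simp)).hasFDerivAt) s).const_smul (lam s)
    rw [h1.fderiv]
    have h2 := congrFun hfoc k
    simp only [Pi.add_apply, grad, mulVec, dotProduct, transpose_apply, jac, Pi.zero_apply] at h2
    rw [← h2]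
    simp [ContinuousLinearMap.sum_apply, mul_comm]
  have hred : hessRed n (fun p => ℓ (w p)) pstar =
      (jacW n m w pstar)ᵀ * (hess n m ℓ zstar +
        ∑ s, lam s • hess n m (fun z => g z s) zstar) * jacW n m w pstar := by
    rw [← hHess]
    ext i j
    have hev : (fun p => ℓ (w p)) =ᶠ[nhds pstar] fun p => L (w p) := by
      filter_upwards [hPopen.mem_nhds hpmem] with p hp
      simp [hLdef, hconstr p hp]
    have h1 : iteratedFDeriv ℝ 2 (fun p => ℓ (w p)) pstar
        = iteratedFDeriv ℝ 2 (fun p => L (w p)) pstar := (hev.iteratedFDeriv ℝ 2).eq_of_nhds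
    rw [hessRed, h1, aux_hess_comp L w pstar (hwp ▸ hL) hwA (hwp ▸ hD0), aux_jacW_expand,
      aux_jacW_expand, aux_bilin, hwp, Matrix.mul_assoc, Matrix.mul_apply]
    rfl
  rw [hred]
  exact aux_linalg n m _ _ hGq _ hJw hsoc
end
end
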